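/- arXiv:2203.14343 — 3 statements merged into one kernel-verified Lean document; each statement's English description precedes it below -/
import Mathlib

section
/- Let λ ∈ ℂ with λ ≠ 0, let Δ > 0 be real, let L be a positive integer with exp(λ·Δ·L) ≠ 1, let p ∈ {0, 1}, and let u : ℕ → ℂ. Define x̃ : ℕ → ℂ by x̃_0 = u_0 and x̃_k = exp(λ·Δ·(1−p))·x̃_{k−1} + exp(−k·λ·Δ·p)·u_k for k ≥ 1, and define x_k = x̃_k · (exp(λ·Δ·p·(k−(L−1))) / λ) · (exp(λ·Δ·(1−2p)) − 1) / (exp(λ·Δ·(1−2p)·L) − 1). Then x satisfies the recurrence x_0 = u_0·(exp(λ·Δ) − 1)/(λ·(exp(λ·Δ·L) − 1)) and x_k = exp(λ·Δ)·x_{k−1} + u_k·(exp(λ·Δ) − 1)/(λ·(exp(λ·Δ·L) − 1)) for all k ≥ 1. (Note exp(λ·Δ·(1−2p)·L) ≠ 1 follows from exp(λ·Δ·L) ≠ 1 for p ∈ {0,1}.) -/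
open Complex

theorem dss_softmax_stable_recurrence (lam : ℂ) (hlam : lam ≠ 0)
    (Δ : ℝ) (hΔ : 0 < Δ) (L : ℕ) (hL : 0 < L)
    (hexpL : Complex.exp (lam * (Δ : ℂ) * (L : ℂ)) ≠ 1)
    (p : ℂ) (hp : p = 0 ∨ p = 1) (u : ℕ → ℂ)
    (xt : ℕ → ℂ) (hxt0 : xt 0 = u 0)
    (hxt : ∀ k : ℕ, 1 ≤ k →
      xt k = Complex.exp (lam * (Δ : ℂ) * (1 - p)) * xt (k - 1) +
        Complex.exp (-(k : ℂ) * lam * (Δ : ℂ) * p) * u k)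
    (x : ℕ → ℂ)
    (hx : ∀ k : ℕ, x k = xt k *
        (Complex.exp (lam * (Δ : ℂ) * p * ((k : ℂ) - ((L : ℂ) - 1))) / lam) *
        (Complex.exp (lam * (Δ : ℂ) * (1 - 2 * p)) - 1) /
        (Complex.exp (lam * (Δ : ℂ) * (1 - 2 * p) * (L : ℂ)) - 1)) :
    x 0 = u 0 * (Complex.exp (lam * (Δ : ℂ)) - 1) /
        (lam * (Complex.exp (lam * (Δ : ℂ) * (L : ℂ)) - 1)) ∧
    ∀ k : ℕ, 1 ≤ k →
      x k = Complex.exp (lam * (Δ : ℂ)) * x (k - 1) +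
        u k * (Complex.exp (lam * (Δ : ℂ)) - 1) /
          (lam * (Complex.exp (lam * (Δ : ℂ) * (L : ℂ)) - 1)) := by
  have hE : Complex.exp (lam * (Δ : ℂ) * (L : ℂ)) - 1 ≠ 0 := sub_ne_zero.mpr hexpL
  have key : ∀ k : ℕ, x k = xt k * Complex.exp (lam * (Δ : ℂ) * p * (k : ℂ)) *
      ((Complex.exp (lam * (Δ : ℂ)) - 1) /
        (lam * (Complex.exp (lam * (Δ : ℂ) * (L : ℂ)) - 1))) := by
    intro k
    rw [hx k]
    rcases hp with rfl | rfl
    · simp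
      field_simp
    · have h1 : Complex.exp (lam * (Δ : ℂ) * 1 * ((k : ℂ) - ((L : ℂ) - 1))) =
          Complex.exp (lam * (Δ : ℂ) * 1 * (k : ℂ)) * Complex.exp (lam * (Δ : ℂ)) *
            (Complex.exp (lam * (Δ : ℂ) * (L : ℂ)))⁻¹ := by
        rw [← Complex.exp_neg, ← Complex.exp_add, ← Complex.exp_add]
        congr 1
        ring
      have h2 : Complex.exp (lam * (Δ : ℂ) * (1 - 2 * 1)) =
          (Complex.exp (lam * (Δ : ℂ)))⁻¹ := by
        rw [← Complex.exp_neg]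
        congr 1
        ring
      have h3 : Complex.exp (lam * (Δ : ℂ) * (1 - 2 * 1) * (L : ℂ)) =
          (Complex.exp (lam * (Δ : ℂ) * (L : ℂ)))⁻¹ := by
        rw [← Complex.exp_neg]
        congr 1
        ring
      rw [h1, h2, h3]
      have hA := Complex.exp_ne_zero (lam * (Δ : ℂ))
      have hB := Complex.exp_ne_zero (lam * (Δ : ℂ) * (L : ℂ))
      generalize Complex.exp (lam * (Δ : ℂ)) = A at *
      generalize Complex.exp (lam * (Δ : ℂ) * (L : ℂ)) = B at *
      generalize Complex.exp (lam * (Δ : ℂ) * 1 * (k : ℂ)) = K at *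
      have hB' : B⁻¹ - 1 ≠ 0 := by
        intro h
        exact hexpL (inv_eq_one.mp (sub_eq_zero.mp h))
      rw [mul_div_assoc', div_mul_eq_mul_div, div_div, mul_div_assoc',
        div_eq_div_iff (mul_ne_zero hlam hB') (mul_ne_zero hlam hE)]
      field_simp
      ring
  refine ⟨?_, ?_⟩
  · rw [key 0, hxt0]
    simp
    ring
  · intro k hk
    obtain ⟨n, rfl⟩ : ∃ n, k = n + 1 := ⟨k - 1, by omega⟩
    rw [key (n + 1), hxt (n + 1) hk, Nat.add_sub_cancel, key n]
    have e1 : Complex.exp (lam * (Δ : ℂ) * (1 - p)) *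
        Complex.exp (lam * (Δ : ℂ) * p * ((n + 1 : ℕ) : ℂ)) =
        Complex.exp (lam * (Δ : ℂ)) * Complex.exp (lam * (Δ : ℂ) * p * (n : ℂ)) := by
      rw [← Complex.exp_add, ← Complex.exp_add]
      congr 1
      push_cast
      ring
    have e2 : Complex.exp (-((n + 1 : ℕ) : ℂ) * lam * (Δ : ℂ) * p) *
        Complex.exp (lam * (Δ : ℂ) * p * ((n + 1 : ℕ) : ℂ)) = 1 := by
      rw [← Complex.exp_add, ← Complex.exp_zero]
      congr 1
      ring
    rw [mul_div_assoc]
    generalize (Complex.exp (lam * (Δ : ℂ)) - 1) /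
        (lam * (Complex.exp (lam * (Δ : ℂ) * (L : ℂ)) - 1)) = C
    linear_combination (xt n * C) * e1 + (u (n + 1) * C) * e2
end

section
/- Let L be a positive integer, ω = exp(−2πi/L) ∈ ℂ, and let e ∈ ℂ satisfy e^L ≠ 1. Then for every 0 ≤ j < L, (1/L) · Σ_{k=0}^{L−1} ω^{−j·k} · (1 − e)/(ω^k − e) = (1 − e)·e^{L−1−j} / (1 − e^L). (All denominators are nonzero: (ω^k)^L = 1 ≠ e^L implies ω^k ≠ e.) -/
open Complex Finset

theorem inverse_dft_geometric_case2 (L : ℕ) (hL : 0 < L)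
    (ω : ℂ) (hω : ω = Complex.exp (-(2 * (Real.pi : ℂ) * Complex.I) / (L : ℂ)))
    (e : ℂ) (he : e ^ L ≠ 1) :
    ∀ j < L, (1 / (L : ℂ)) * ∑ k ∈ Finset.range L,
        ω ^ (-(j * k : ℤ)) * ((1 - e) / (ω ^ k - e)) =
      (1 - e) * e ^ (L - 1 - j) / (1 - e ^ L) := by
  intro j hj
  have hprim : IsPrimitiveRoot ω L := by
    have h := (Complex.isPrimitiveRoot_exp L hL.ne').inv
    rw [← Complex.exp_neg, ← neg_div] at h
    rw [hω]
    exact h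
  have hω0 : ω ≠ 0 := hprim.ne_zero hL.ne'
  have hLc : (L : ℂ) ≠ 0 := by exact_mod_cast hL.ne'
  have h1 : (1 - e ^ L) ≠ 0 := sub_ne_zero.mpr (Ne.symm he)
  have hterm : ∀ k : ℕ, (1 - e) / (ω ^ k - e) =
      (1 - e) / (1 - e ^ L) * ∑ i ∈ Finset.range L, (ω ^ k) ^ i * e ^ (L - 1 - i) := by
    intro k
    have hk : (ω ^ k) ^ L = 1 := by rw [← pow_mul, mul_comm, pow_mul, hprim.pow_eq_one, one_pow]
    have hg := geom_sum₂_mul (ω ^ k) e L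
    rw [hk] at hg
    have hne : ω ^ k - e ≠ 0 := by
      intro h
      rw [h, mul_zero] at hg
      exact h1 hg.symm
    rw [div_eq_iff hne, mul_assoc, hg, div_mul_cancel₀ _ h1]
  have horth : ∀ i ∈ Finset.range L, ∑ k ∈ Finset.range L, ω ^ (-(j * k : ℤ)) * (ω ^ k) ^ i =
      if i = j then (L : ℂ) else 0 := by
    intro i hi
    have hi' := Finset.mem_range.mp hi
    have hr : ∀ k : ℕ, ω ^ (-(j * k : ℤ)) * (ω ^ k) ^ i = (ω ^ ((i : ℤ) - j)) ^ k := by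
      intro k
      rw [← pow_mul, ← zpow_natCast, ← zpow_natCast, ← zpow_mul, ← zpow_add₀ hω0]
      congr 1
      push_cast
      ring
    simp_rw [hr]
    split_ifs with hij
    · subst hij
      simp
    · have hne : ω ^ ((i : ℤ) - j) ≠ 1 := by
        intro h
        rw [hprim.zpow_eq_one_iff_dvd] at h
        have := Int.eq_zero_of_abs_lt_dvd h (by rw [abs_lt]; omega)
        omega
      rw [geom_sum_eq hne, ← zpow_natCast, ← zpow_mul, mul_comm, zpow_mul, zpow_natCast,
        hprim.pow_eq_one, one_zpow, sub_self, zero_div]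
  have hsum : ∑ k ∈ Finset.range L, ω ^ (-(j * k : ℤ)) * ((1 - e) / (ω ^ k - e)) =
      (1 - e) / (1 - e ^ L) * ∑ i ∈ Finset.range L,
        (∑ k ∈ Finset.range L, ω ^ (-(j * k : ℤ)) * (ω ^ k) ^ i) * e ^ (L - 1 - i) := by
    simp_rw [hterm, Finset.sum_mul, Finset.mul_sum]
    rw [Finset.sum_comm]
    refine Finset.sum_congr rfl fun i _ => Finset.sum_congr rfl fun k _ => ?_
    ring
  rw [hsum, Finset.sum_congr rfl fun i hi => by rw [horth i hi]]
  simp only [ite_mul, zero_mul, Finset.sum_ite_eq', Finset.mem_range, hj, if_true]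
  field_simp
end

section
/- Let L be a positive integer and c ∈ ℂ with exp(c·L) ≠ 1. Set p = 1 if Re(c) > 0 and p = 0 otherwise, n = 1 − p, e = exp(c·(n − p)), r = (n − p·e)/(p − n·e), and ω = exp(−2πi/L). Then for every 0 ≤ j < L, softmax(c·0, c·1, …, c·(L−1))_j = (1/L) · Σ_{k=0}^{L−1} ω^{−j·k} · (r + 1)/(r + ω^k), where softmax(x_0, …, x_{L−1})_j = exp(x_j) / (exp(x_0) + ⋯ + exp(x_{L−1})). (The hypotheses guarantee all denominators, including p − n·e, r + ω^k, and Σ_{k<L} exp(c·k), are nonzero.) -/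
open Complex Finset

theorem ssm_orth (L : ℕ) (ω : ℂ) (h : IsPrimitiveRoot ω L) (hL : 0 < L) (j m : ℕ)
    (hj : j < L) (hm : m < L) :
    ∑ k ∈ Finset.range L, ω ^ (-(j * k : ℤ)) * (ω ^ k) ^ m = if m = j then (L : ℂ) else 0 := by
  have h0 : ω ≠ 0 := h.ne_zero hL.ne'
  have key : ∀ k : ℕ, ω ^ (-(j * k : ℤ)) * (ω ^ k) ^ m = (ω ^ ((m : ℤ) - j)) ^ k := by
    intro k
    rw [← zpow_natCast (ω ^ ((m : ℤ) - j)) k, ← zpow_mul, ← pow_mul, ← zpow_natCast ω (k * m),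
      ← zpow_add₀ h0]
    congr 1
    push_cast
    ring
  simp_rw [key]
  split_ifs with hmj
  · subst hmj
    simp
  · have hne : ω ^ ((m : ℤ) - j) ≠ 1 := by
      intro h1
      rw [h.zpow_eq_one_iff_dvd] at h1
      obtain ⟨t, ht⟩ := h1
      have : t = 0 := by
        by_contra h2
        rcases lt_or_gt_of_ne h2 with h3 | h3 <;> nlinarith
      subst this
      omega
    rw [geom_sum_eq hne, ← zpow_natCast (ω ^ ((m : ℤ) - j)) L, ← zpow_mul, mul_comm, zpow_mul,
      zpow_natCast, h.pow_eq_one]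
    simp

theorem ssm_softmax_inverse_dft (L : ℕ) (hL : 0 < L) (c : ℂ)
    (hc : Complex.exp (c * (L : ℂ)) ≠ 1)
    (p : ℂ) (hp : p = if 0 < c.re then 1 else 0)
    (n : ℂ) (hn : n = 1 - p)
    (e : ℂ) (he : e = Complex.exp (c * (n - p)))
    (r : ℂ) (hr : r = (n - p * e) / (p - n * e))
    (ω : ℂ) (hω : ω = Complex.exp (-(2 * (Real.pi : ℂ) * Complex.I) / (L : ℂ))) :
    ∀ j < L,
      Complex.exp (c * (j : ℂ)) / (∑ k ∈ Finset.range L, Complex.exp (c * (k : ℂ))) =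
        (1 / (L : ℂ)) * ∑ k ∈ Finset.range L,
          ω ^ (-(j * k : ℤ)) * ((r + 1) / (r + ω ^ k)) := by
  intro j hj
  have hprim : IsPrimitiveRoot ω L := by
    have h := (Complex.isPrimitiveRoot_exp L hL.ne').inv
    rwa [← Complex.exp_neg, ← neg_div, ← hω] at h
  have hr' : r = -(Complex.exp c)⁻¹ := by
    rw [hr, he, hn, hp]
    split_ifs
    · simp [Complex.exp_neg]
    · simp [div_neg]
  have hpow : ∀ k : ℕ, Complex.exp (c * (k : ℂ)) = Complex.exp c ^ k := by
    intro k
    rw [mul_comm, Complex.exp_nat_mul]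
  simp_rw [hpow] at hc ⊢
  have hz : Complex.exp c ≠ 0 := Complex.exp_ne_zero c
  generalize Complex.exp c = z at *
  have hz1 : z ≠ 1 := by
    rintro rfl
    simp at hc
  have hzL : z ^ L - 1 ≠ 0 := sub_ne_zero.mpr hc
  have hLc : (L : ℂ) ≠ 0 := by exact_mod_cast hL.ne'
  have term : ∀ k : ℕ, (r + 1) / (r + ω ^ k)
      = (z - 1) / (z ^ L - 1) * ∑ m ∈ Finset.range L, z ^ m * (ω ^ k) ^ m := by
    intro k
    have hwL : (z * ω ^ k) ^ L = z ^ L := by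
      rw [mul_pow, ← pow_mul, mul_comm k L, pow_mul, hprim.pow_eq_one, one_pow, mul_one]
    have hne : z * ω ^ k ≠ 1 := by
      intro h
      rw [h, one_pow] at hwL
      exact hc hwL.symm
    have hne' : z * ω ^ k - 1 ≠ 0 := sub_ne_zero.mpr hne
    simp_rw [← mul_pow]
    rw [geom_sum_eq hne, hwL, hr']
    have e1 : -z⁻¹ + 1 = z⁻¹ * (z - 1) := by field_simp; ring
    have e2 : -z⁻¹ + ω ^ k = z⁻¹ * (z * ω ^ k - 1) := by field_simp; ring
    rw [e1, e2, mul_div_mul_left _ _ (inv_ne_zero hz)]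
    field_simp
  simp_rw [term]
  have hsum : ∑ k ∈ Finset.range L, ω ^ (-(j * k : ℤ)) *
      ((z - 1) / (z ^ L - 1) * ∑ m ∈ Finset.range L, z ^ m * (ω ^ k) ^ m)
      = (z - 1) / (z ^ L - 1) * (z ^ j * L) := by
    calc _ = (z - 1) / (z ^ L - 1) * ∑ m ∈ Finset.range L, z ^ m *
          ∑ k ∈ Finset.range L, ω ^ (-(j * k : ℤ)) * (ω ^ k) ^ m := by
          simp_rw [Finset.mul_sum]
          rw [Finset.sum_comm]
          refine Finset.sum_congr rfl fun m _ => Finset.sum_congr rfl fun k _ => ?_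
          ring
      _ = (z - 1) / (z ^ L - 1) * ∑ m ∈ Finset.range L, z ^ m *
          (if m = j then (L : ℂ) else 0) := by
          congr 1
          refine Finset.sum_congr rfl fun m hm => ?_
          rw [ssm_orth L ω hprim hL j m hj (Finset.mem_range.mp hm)]
      _ = _ := by
          simp [hj]
  rw [hsum, geom_sum_eq hz1]
  have := sub_ne_zero.mpr hz1
  field_simp
end
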